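/- For every positive integer i there exists a unique θ_i ∈ (0, 1) with 2|ψ^(i)(θ_i)| = |ψ^(i)(θ_i²)|, and the function F(x) = |ψ^(i)(e^x)| is sub-additive on (ln θ_i, ∞): for all x, y > ln θ_i, F(x + y) ≤ F(x) + F(y). -/

import Mathlib

noncomputable def digamma : ℝ → ℝ := deriv (fun x => Real.log (Real.Gamma x))

noncomputable def polygamma (i : ℕ) : ℝ → ℝ := iteratedDeriv i digamma

open Filter Set Topology

/-- The series `∑ 1 / (x + k) ^ p` over natural numbers `k`. -/
noncomputable def zetaSeries (p : ℕ) (x : ℝ) : ℝ := ∑' k : ℕ, 1 / (x + k) ^ p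

lemma summable_zetaSeries {p : ℕ} (hp : 2 ≤ p) {x : ℝ} (hx : 0 < x) :
    Summable fun k : ℕ => 1 / (x + k) ^ p := by
  have h := (Real.summable_one_div_nat_add_rpow x p).2 (by exact_mod_cast hp)
  refine h.congr fun k => ?_
  have : 0 < (k : ℝ) + x := by positivity
  rw [abs_of_pos this, Real.rpow_natCast, add_comm]

lemma zetaSeries_pos {p : ℕ} (hp : 2 ≤ p) {x : ℝ} (hx : 0 < x) : 0 < zetaSeries p x :=
  (summable_zetaSeries hp hx).tsum_pos (fun k => by positivity) 0 (by positivity)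

lemma zetaSeries_antitoneOn {p : ℕ} (hp : 2 ≤ p) : AntitoneOn (zetaSeries p) (Ioi 0) := by
  intro x hx y hy hxy
  rw [mem_Ioi] at hx hy
  refine (summable_zetaSeries hp hy).tsum_le_tsum (fun k => ?_) (summable_zetaSeries hp hx)
  gcongr

lemma zetaSeries_eq_add {p : ℕ} (hp : 2 ≤ p) {x : ℝ} (hx : 0 < x) :
    zetaSeries p x = 1 / x ^ p + zetaSeries p (x + 1) := by
  rw [zetaSeries, (summable_zetaSeries hp hx).tsum_eq_zero_add]
  simp [zetaSeries, add_assoc, add_comm (1 : ℝ)]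

lemma hasDerivAt_one_div_add_pow (p : ℕ) {y c : ℝ} (h : 0 < y + c) :
    HasDerivAt (fun y => 1 / (y + c) ^ p) (-(p * (1 / (y + c) ^ (p + 1)))) y := by
  have h1 := ((((hasDerivAt_id y).add_const c).pow p).inv (pow_pos h p).ne')
  simp only [one_div]
  refine h1.congr_deriv ?_
  rcases p with _ | p
  · simp
  · simp only [id]
    field_simp
    simp only [add_tsub_cancel_right, Pi.pow_apply]
    ring

lemma hasDerivAt_zetaSeries {p : ℕ} (hp : 2 ≤ p) {x : ℝ} (hx : 0 < x) :
    HasDerivAt (zetaSeries p) (-(p * zetaSeries (p + 1) x)) x := by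
  have hx2 : 0 < x / 2 := by positivity
  have h : -(p * zetaSeries (p + 1) x) = ∑' k : ℕ, -((p : ℝ) * (1 / (x + k) ^ (p + 1))) := by
    rw [zetaSeries, ← tsum_mul_left, ← tsum_neg]
  rw [h]
  refine hasDerivAt_tsum_of_isPreconnected (t := Ioi (x / 2)) (y₀ := x)
    (g := fun (k : ℕ) (y : ℝ) => 1 / (y + k) ^ p)
    (g' := fun (k : ℕ) (y : ℝ) => -((p : ℝ) * (1 / (y + k) ^ (p + 1))))
    ((summable_zetaSeries (p := p + 1) (by omega) hx2).mul_left (p : ℝ)) isOpen_Ioi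
    isPreconnected_Ioi (fun k y hy => ?_) (fun k y hy => ?_) (by simpa using hx)
    (summable_zetaSeries hp hx) (by simpa using hx)
  · have : 0 < y := hx2.trans hy
    exact hasDerivAt_one_div_add_pow p (by positivity)
  · have : 0 < y := hx2.trans hy
    rw [mem_Ioi] at hy
    rw [norm_neg, Real.norm_of_nonneg (by positivity)]
    gcongr

/-- A telescoping bound coming from the trapezoidal rule. -/
lemma one_div_cube_sub_le {x y : ℝ} (hx : 0 < x) (hy : 0 < y) :
    1 / y ^ 3 - 3 * x * (1 / y ^ 4) ≤
      (1 / (2 * y ^ 2) + 1 / y ^ 3 - x * (1 / y ^ 3 + 3 / (2 * y ^ 4))) -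
      (1 / (2 * (y + 1) ^ 2) + 1 / (y + 1) ^ 3 -
        x * (1 / (y + 1) ^ 3 + 3 / (2 * (y + 1) ^ 4))) := by
  have h1 : 1 / y ^ 3 ≤ (1 / (2 * y ^ 2) + 1 / y ^ 3) -
      (1 / (2 * (y + 1) ^ 2) + 1 / (y + 1) ^ 3) := by
    rw [← sub_nonneg]
    have : (1 / (2 * y ^ 2) + 1 / y ^ 3) - (1 / (2 * (y + 1) ^ 2) + 1 / (y + 1) ^ 3) - 1 / y ^ 3
        = (3 * y + 1) / (2 * y ^ 2 * (y + 1) ^ 3) := by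
      field_simp
      ring
    rw [this]
    positivity
  have h2 : (1 / y ^ 3 + 3 / (2 * y ^ 4)) - (1 / (y + 1) ^ 3 + 3 / (2 * (y + 1) ^ 4)) ≤
      3 * (1 / y ^ 4) := by
    rw [← sub_nonneg]
    have : 3 * (1 / y ^ 4) -
        ((1 / y ^ 3 + 3 / (2 * y ^ 4)) - (1 / (y + 1) ^ 3 + 3 / (2 * (y + 1) ^ 4)))
        = (10 * y ^ 2 + 10 * y + 3) / (2 * y ^ 4 * (y + 1) ^ 4) := by
      field_simp
      ring
    rw [this]
    positivity
  have h3 := mul_le_mul_of_nonneg_left h2 hx.le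
  linarith

lemma zetaSeries_three_lt {x : ℝ} (hx : 0 < x) : zetaSeries 3 x < 3 * x * zetaSeries 4 x := by
  have h3 := summable_zetaSeries (p := 3) (by norm_num) hx
  have h4 := (summable_zetaSeries (p := 4) (by norm_num) hx).mul_left (3 * x)
  set c : ℝ → ℝ := fun y => 1 / (2 * y ^ 2) + 1 / y ^ 3 - x * (1 / y ^ 3 + 3 / (2 * y ^ 4))
    with hc
  have hsum : ∀ n : ℕ, ∑ k ∈ Finset.range n, (1 / (x + k) ^ 3 - 3 * x * (1 / (x + k) ^ 4)) ≤
      c x - c (x + n) := by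
    intro n
    induction n with
    | zero => simp
    | succ n ih =>
      rw [Finset.sum_range_succ]
      have := one_div_cube_sub_le hx (y := x + n) (by positivity)
      simp only [hc] at ih ⊢
      push_cast
      rw [← add_assoc]
      linarith
  have hlim : Tendsto (fun n : ℕ => c x - c (x + n)) atTop (𝓝 (c x - 0)) := by
    have h : Tendsto (fun n : ℕ => (x + n)⁻¹) atTop (𝓝 0) :=
      (tendsto_atTop_add_const_left _ x tendsto_natCast_atTop_atTop).inv_tendsto_atTop
    have h' : Tendsto (fun u : ℝ => u ^ 2 / 2 + u ^ 3 - x * (u ^ 3 + 3 / 2 * u ^ 4)) (𝓝 0)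
        (𝓝 0) := by
      have : Continuous fun u : ℝ => u ^ 2 / 2 + u ^ 3 - x * (u ^ 3 + 3 / 2 * u ^ 4) := by
        fun_prop
      simpa using this.tendsto 0
    refine tendsto_const_nhds.sub ((h'.comp h).congr fun n => ?_)
    have : x + n ≠ 0 := by positivity
    simp only [hc, Function.comp]
    field_simp
  have hle := le_of_tendsto_of_tendsto' (h3.sub h4).hasSum.tendsto_sum_nat hlim hsum
  rw [h3.tsum_sub h4, tsum_mul_left] at hle
  have hcx : c x = -(x + 1) / (2 * x ^ 3) := by
    simp only [hc]
    field_simp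
    ring
  have : c x < 0 := by
    rw [hcx]
    exact div_neg_of_neg_of_pos (by linarith) (by positivity)
  unfold zetaSeries
  linarith

lemma zetaSeries_lt_mul_zetaSeries_succ {q : ℕ} (hq : 3 ≤ q) {x : ℝ} (hx : 0 < x) :
    zetaSeries q x < q * x * zetaSeries (q + 1) x := by
  obtain ⟨m, rfl⟩ := Nat.exists_eq_add_of_le hq
  have h3 := summable_zetaSeries (p := 3) (by norm_num) hx
  have h4 := (summable_zetaSeries (p := 4) (by norm_num) hx).mul_left (3 * x)
  have hq1 := summable_zetaSeries (p := 3 + m) (by omega) hx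
  have hq2 := (summable_zetaSeries (p := 3 + m + 1) (by omega) hx).mul_left
    (((3 + m : ℕ) : ℝ) * x)
  have key : ∀ k : ℕ, 1 / (x + k) ^ (3 + m) - ((3 + m : ℕ) : ℝ) * x * (1 / (x + k) ^ (3 + m + 1))
      ≤ 1 / (3 * x) ^ m * (1 / (x + k) ^ 3 - 3 * x * (1 / (x + k) ^ 4)) := by
    intro k
    have hy : 0 < x + k := by positivity
    set y := x + k
    have e1 : 1 / y ^ (3 + m) - ((3 + m : ℕ) : ℝ) * x * (1 / y ^ (3 + m + 1)) =
        1 / y ^ 4 * ((y - 3 * x) * (1 / y ^ m)) - m * x * (1 / y ^ (3 + m + 1)) := by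
      push_cast
      field_simp
      ring
    have e2 : 1 / (3 * x) ^ m * (1 / y ^ 3 - 3 * x * (1 / y ^ 4)) =
        1 / y ^ 4 * ((y - 3 * x) * (1 / (3 * x) ^ m)) := by
      field_simp
    have e3 : (y - 3 * x) * (1 / y ^ m) ≤ (y - 3 * x) * (1 / (3 * x) ^ m) := by
      rcases le_total y (3 * x) with h | h
      · exact mul_le_mul_of_nonpos_left (by gcongr) (by linarith)
      · exact mul_le_mul_of_nonneg_left (by gcongr) (by linarith)
    have e4 : 0 ≤ m * x * (1 / y ^ (3 + m + 1)) := by positivity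
    have e5 := mul_le_mul_of_nonneg_left e3 (show 0 ≤ 1 / y ^ 4 by positivity)
    rw [e1, e2]
    linarith
  have hle := (hq1.sub hq2).tsum_le_tsum key ((h3.sub h4).mul_left _)
  rw [hq1.tsum_sub hq2, tsum_mul_left, tsum_mul_left, h3.tsum_sub h4, tsum_mul_left] at hle
  have hneg := mul_neg_of_pos_of_neg (show 0 < 1 / (3 * x) ^ m by positivity)
    (sub_neg.2 (zetaSeries_three_lt hx))
  unfold zetaSeries at hneg ⊢
  linarith

lemma strictAntiOn_mul_zetaSeries {q : ℕ} (hq : 3 ≤ q) :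
    StrictAntiOn (fun x => x * zetaSeries q x) (Ioi 0) := by
  have hd : ∀ x ∈ Ioi (0 : ℝ), HasDerivAt (fun x => x * zetaSeries q x)
      (1 * zetaSeries q x + x * -(q * zetaSeries (q + 1) x)) x := fun x hx =>
    (hasDerivAt_id' x).mul (hasDerivAt_zetaSeries (by omega) hx)
  refine strictAntiOn_of_deriv_neg (convex_Ioi 0)
    (fun x hx => (hd x hx).continuousAt.continuousWithinAt) fun x hx => ?_
  rw [interior_Ioi] at hx
  rw [(hd x hx).deriv]
  have := zetaSeries_lt_mul_zetaSeries_succ hq hx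
  linarith

lemma antitoneOn_zetaSeries_mul_sub {p : ℕ} (hp : 2 ≤ p) {s : ℝ} (hs : 0 < s) (hs1 : s ≤ 1) :
    AntitoneOn (fun t => zetaSeries p (s * t) - zetaSeries p t) (Ioi 0) := by
  have hd : ∀ t ∈ Ioi (0 : ℝ), HasDerivAt (fun t => zetaSeries p (s * t) - zetaSeries p t)
      (-(p * zetaSeries (p + 1) (s * t)) * (s * 1) - -(p * zetaSeries (p + 1) t)) t :=
    fun t ht =>
    ((hasDerivAt_zetaSeries hp (mul_pos hs ht)).comp t ((hasDerivAt_id' t).const_mul s)).sub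
      (hasDerivAt_zetaSeries hp ht)
  refine antitoneOn_of_deriv_nonpos (convex_Ioi 0)
    (fun t ht => (hd t ht).continuousAt.continuousWithinAt) ?_ fun t ht => ?_ <;>
  rw [interior_Ioi] at *
  · exact fun t ht => (hd t ht).differentiableAt.differentiableWithinAt
  have ht0 : 0 < t := ht
  rw [(hd t ht).deriv]
  have h := (strictAntiOn_mul_zetaSeries (q := p + 1) (by omega)).antitoneOn
    (mem_Ioi.2 (mul_pos hs ht)) ht (mul_le_of_le_one_left ht0.le hs1)
  have h' : zetaSeries (p + 1) t ≤ s * zetaSeries (p + 1) (s * t) := by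
    refine le_of_mul_le_mul_left ?_ ht0
    linarith
  have := mul_le_mul_of_nonneg_left h' (show (0 : ℝ) ≤ p by positivity)
  linarith

lemma hasDerivAt_zetaSeries_sq_sub {p : ℕ} (hp : 2 ≤ p) {x : ℝ} (hx : 0 < x) :
    HasDerivAt (fun x => zetaSeries p (x ^ 2) - 2 * zetaSeries p x)
      (-(p * zetaSeries (p + 1) (x ^ 2)) * (2 * x) - 2 * -(p * zetaSeries (p + 1) x)) x := by
  have h2 : HasDerivAt (fun x : ℝ => x ^ 2) (2 * x) x := by simpa using hasDerivAt_pow 2 x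
  exact ((hasDerivAt_zetaSeries hp (pow_pos hx 2)).comp (h₂ := zetaSeries p)
    (h := fun x => x ^ 2) x h2).sub
    ((hasDerivAt_zetaSeries hp hx).const_mul 2)

lemma strictAntiOn_zetaSeries_sq_sub {p : ℕ} (hp : 2 ≤ p) :
    StrictAntiOn (fun x => zetaSeries p (x ^ 2) - 2 * zetaSeries p x) (Ioo 0 1) := by
  refine strictAntiOn_of_deriv_neg (convex_Ioo 0 1)
    (fun x hx => (hasDerivAt_zetaSeries_sq_sub hp hx.1).continuousAt.continuousWithinAt)
    fun x hx => ?_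
  rw [interior_Ioo] at hx
  obtain ⟨hx0, hx1⟩ := hx
  rw [(hasDerivAt_zetaSeries_sq_sub hp hx0).deriv]
  have h := strictAntiOn_mul_zetaSeries (q := p + 1) (by omega)
    (mem_Ioi.2 (pow_pos hx0 2)) (mem_Ioi.2 hx0) (by nlinarith)
  have h' : zetaSeries (p + 1) x < x * zetaSeries (p + 1) (x ^ 2) := by
    refine lt_of_mul_lt_mul_left ?_ hx0.le
    dsimp only at h
    linarith
  have := mul_lt_mul_of_pos_left h' (show (0 : ℝ) < p by positivity)
  linarith

lemma exists_zetaSeries_sq_eq {p : ℕ} (hp : 2 ≤ p) :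
    ∃ θ ∈ Ioo (0 : ℝ) 1, zetaSeries p (θ ^ 2) - 2 * zetaSeries p θ = 0 := by
  set C := zetaSeries p 1
  have hC : 0 < C := zetaSeries_pos hp one_pos
  set u := 3 + 2 * C
  have hu : 1 ≤ u := by simp only [u]; linarith
  have hε : 0 < u⁻¹ := by positivity
  have hε1 : u⁻¹ ≤ 1 := inv_le_one_of_one_le₀ hu
  have hleft : 0 < zetaSeries p (u⁻¹ ^ 2) - 2 * zetaSeries p u⁻¹ := by
    have h1 := zetaSeries_eq_add hp hε
    have h2 := zetaSeries_eq_add hp (pow_pos hε 2)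
    have h3 : zetaSeries p (u⁻¹ + 1) ≤ C :=
      zetaSeries_antitoneOn hp (mem_Ioi.2 one_pos) (mem_Ioi.2 (by positivity)) (by linarith)
    have h4 := zetaSeries_pos hp (show 0 < u⁻¹ ^ 2 + 1 by positivity)
    have e1 : 1 / u⁻¹ ^ p = u ^ p := by simp
    have e2 : 1 / (u⁻¹ ^ 2) ^ p = (u ^ p) ^ 2 := by rw [← pow_mul, ← pow_mul, mul_comm p 2]; simp
    have h5 : u ≤ u ^ p := le_self_pow₀ hu (by omega)
    rw [e1] at h1
    rw [e2] at h2
    have h6 : 3 + 2 * C ≤ u ^ p := h5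
    nlinarith
  have hright : zetaSeries p (1 ^ 2) - 2 * zetaSeries p 1 < 0 := by
    rw [one_pow]
    linarith
  obtain ⟨θ, hθ, h0⟩ := intermediate_value_Ioo'
    (f := fun x => zetaSeries p (x ^ 2) - 2 * zetaSeries p x) hε1
    (fun x hx =>
      (hasDerivAt_zetaSeries_sq_sub hp (hε.trans_le hx.1)).continuousAt.continuousWithinAt)
    ⟨hright, hleft⟩
  exact ⟨θ, ⟨hε.trans hθ.1, hθ.2⟩, h0⟩

lemma zetaSeries_mul_le {p : ℕ} (hp : 2 ≤ p) {θ : ℝ} (hθ : θ ∈ Ioo (0 : ℝ) 1)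
    (h0 : zetaSeries p (θ ^ 2) - 2 * zetaSeries p θ = 0) {s t : ℝ} (hs : θ < s) (hst : s ≤ t) :
    zetaSeries p (s * t) ≤ zetaSeries p s + zetaSeries p t := by
  have hs0 := hθ.1.trans hs
  have ht0 := hs0.trans_le hst
  rcases le_or_gt 1 t with ht | ht
  · have h1 : zetaSeries p (s * t) ≤ zetaSeries p s :=
      zetaSeries_antitoneOn hp hs0 (mem_Ioi.2 (mul_pos hs0 ht0)) (le_mul_of_one_le_right hs0.le ht)
    have h2 := zetaSeries_pos hp ht0
    linarith
  · have h1 := antitoneOn_zetaSeries_mul_sub hp hs0 (hst.trans ht.le) hs0 ht0 hst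
    have h2 := strictAntiOn_zetaSeries_sq_sub hp hθ ⟨hs0, hst.trans_lt ht⟩ hs
    simp only [← pow_two] at h1 h2
    linarith

lemma differentiableAt_log_Gamma {x : ℝ} (hx : 0 < x) :
    DifferentiableAt ℝ (fun x => Real.log (Real.Gamma x)) x :=
  (Real.differentiableOn_Gamma_Ioi.differentiableAt (Ioi_mem_nhds hx)).log
    (Real.Gamma_pos_of_pos hx).ne'

lemma digamma_add_one {x : ℝ} (hx : 0 < x) : digamma (x + 1) = digamma x + 1 / x := by
  unfold digamma
  rw [← deriv_comp_add_const]
  have h : (fun x => Real.log (Real.Gamma (x + 1))) =ᶠ[𝓝 x]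
      fun x => Real.log (Real.Gamma x) + Real.log x := by
    filter_upwards [Ioi_mem_nhds hx] with y hy
    rw [Real.Gamma_add_one (ne_of_gt hy),
      Real.log_mul (ne_of_gt hy) (Real.Gamma_pos_of_pos hy).ne', add_comm]
  rw [h.deriv_eq, deriv_fun_add (differentiableAt_log_Gamma hx)
    (Real.differentiableAt_log hx.ne'), Real.deriv_log, one_div]

lemma monotoneOn_digamma : MonotoneOn digamma (Ioi 0) :=
  Real.convexOn_log_Gamma.monotoneOn_deriv fun _ hx => differentiableAt_log_Gamma hx

lemma digamma_add_nat {x : ℝ} (hx : 0 < x) (n : ℕ) :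
    digamma (x + n) = digamma x + ∑ k ∈ Finset.range n, 1 / (x + k) := by
  induction n with
  | zero => simp
  | succ n ih =>
    rw [Finset.sum_range_succ, Nat.cast_succ, ← add_assoc, digamma_add_one (by positivity), ih]
    ring

lemma tendsto_digamma_add_sub {a : ℝ} (ha : 0 < a) (N : ℕ) :
    Tendsto (fun n : ℕ => digamma (a + n + N) - digamma (a + n)) atTop (𝓝 0) := by
  have h : ∀ n : ℕ, digamma (a + n + N) - digamma (a + n) =
      ∑ k ∈ Finset.range N, 1 / (a + n + k) := fun n => by
    rw [digamma_add_nat (by positivity)]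
    ring
  simp only [h]
  rw [← Finset.sum_const_zero (s := Finset.range N)]
  refine tendsto_finsetSum _ fun k _ => ?_
  simp only [one_div]
  exact (tendsto_atTop_add_const_right _ _
    (tendsto_atTop_add_const_left _ a tendsto_natCast_atTop_atTop)).inv_tendsto_atTop

lemma tendsto_digamma_sub {x y : ℝ} (hx : 0 < x) (hy : 0 < y) :
    Tendsto (fun n : ℕ => digamma (x + n) - digamma (y + n)) atTop (𝓝 0) := by
  obtain ⟨N, hN⟩ := exists_nat_ge (x + y)
  have h1 := tendsto_digamma_add_sub hx N
  have h2 := tendsto_digamma_add_sub hy N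
  refine tendsto_of_tendsto_of_tendsto_of_le_of_le (by simpa using h1.neg) h2 (fun n => ?_)
    fun n => ?_
  · have := monotoneOn_digamma (show y + n ∈ Ioi 0 by simp only [mem_Ioi]; positivity)
      (show x + n + N ∈ Ioi 0 by simp only [mem_Ioi]; positivity) (by linarith)
    simp only
    linarith
  · have := monotoneOn_digamma (show x + n ∈ Ioi 0 by simp only [mem_Ioi]; positivity)
      (show y + n + N ∈ Ioi 0 by simp only [mem_Ioi]; positivity) (by linarith)
    simp only
    linarith

lemma hasDerivAt_digamma {x : ℝ} (hx : 0 < x) : HasDerivAt digamma (zetaSeries 2 x) x := by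
  set a := min x 1 / 2
  have hm : 0 < min x 1 := lt_min hx one_pos
  have ha : 0 < a := by positivity
  have hax : a < x := by have := min_le_left x 1; simp only [a]; linarith
  have ha1 : a < 1 := by have := min_le_right x 1; simp only [a]; linarith
  have hg : ∀ (k : ℕ), ∀ y ∈ Ioi a, HasDerivAt (fun y : ℝ => 1 / (1 + (k : ℝ)) - 1 / (y + k))
      (1 / (y + k) ^ 2) y := by
    intro k y hy
    have hy0 : 0 < y := ha.trans hy
    simpa using (hasDerivAt_one_div_add_pow 1 (c := k) (show 0 < y + k by positivity)).const_sub
      (1 / (1 + (k : ℝ)))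
  have hg' : ∀ (k : ℕ), ∀ y ∈ Ioi a, ‖1 / (y + k) ^ 2‖ ≤ 1 / (a + k) ^ 2 := by
    intro k y hy
    have hy0 : 0 < y := ha.trans hy
    rw [mem_Ioi] at hy
    rw [Real.norm_of_nonneg (by positivity)]
    gcongr
  have hu := summable_zetaSeries (p := 2) le_rfl ha
  have h1 : Summable fun k : ℕ => 1 / (1 + (k : ℝ)) - 1 / (1 + (k : ℝ)) := by
    simp [summable_zero]
  have hD := hasDerivAt_tsum_of_isPreconnected hu isOpen_Ioi isPreconnected_Ioi hg hg'
    (mem_Ioi.2 ha1) h1 (mem_Ioi.2 hax)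
  refine (hD.const_add (digamma 1)).congr_of_eventuallyEq ?_
  filter_upwards [Ioi_mem_nhds hax] with y hy
  have hy0 : 0 < y := ha.trans hy
  have hs := (summable_of_summable_hasDerivAt_of_isPreconnected hu isOpen_Ioi isPreconnected_Ioi
    hg hg' (mem_Ioi.2 ha1) h1 hy).hasSum.tendsto_sum_nat
  have hl := (tendsto_digamma_sub one_pos hy0).const_add (digamma y - digamma 1)
  rw [add_zero] at hl
  have := tendsto_nhds_unique hs (hl.congr fun n => by
    rw [digamma_add_nat one_pos, digamma_add_nat hy0, Finset.sum_sub_distrib]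
    ring)
  linarith

lemma polygamma_succ_eq (n : ℕ) {x : ℝ} (hx : 0 < x) :
    polygamma (n + 1) x = (-1) ^ n * (n + 1).factorial * zetaSeries (n + 2) x := by
  unfold polygamma
  induction n generalizing x with
  | zero => simp [iteratedDeriv_one, (hasDerivAt_digamma hx).deriv]
  | succ n ih =>
    have h : iteratedDeriv (n + 1) digamma =ᶠ[𝓝 x]
        fun x => (-1) ^ n * (n + 1).factorial * zetaSeries (n + 2) x := by
      filter_upwards [Ioi_mem_nhds hx] with y hy using ih hy
    rw [iteratedDeriv_succ, h.deriv_eq,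
      ((hasDerivAt_zetaSeries (by omega) hx).const_mul _).deriv, Nat.factorial_succ (n + 1)]
    push_cast
    ring

lemma abs_polygamma {i : ℕ} (hi : 0 < i) {x : ℝ} (hx : 0 < x) :
    |polygamma i x| = i.factorial * zetaSeries (i + 1) x := by
  obtain ⟨n, rfl⟩ := Nat.exists_eq_add_one.2 hi
  rw [polygamma_succ_eq n hx, abs_mul, abs_mul, abs_pow, abs_neg, abs_one, one_pow, one_mul,
    Nat.abs_cast, abs_of_pos (zetaSeries_pos (by omega) hx)]

theorem stmt11 (i : ℕ) (hi : 0 < i) :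
    ∃ θ : ℝ, θ ∈ Set.Ioo (0 : ℝ) 1 ∧
      2 * |polygamma i θ| = |polygamma i (θ ^ 2)| ∧
      (∀ θ' ∈ Set.Ioo (0 : ℝ) 1, 2 * |polygamma i θ'| = |polygamma i (θ' ^ 2)| → θ' = θ) ∧
      ∀ x y : ℝ, Real.log θ < x → Real.log θ < y →
        |polygamma i (Real.exp (x + y))| ≤ |polygamma i (Real.exp x)| + |polygamma i (Real.exp y)| := by
  have hp : 2 ≤ i + 1 := by omega
  have hf : (0 : ℝ) < i.factorial := by positivity
  have habs : ∀ x : ℝ, 0 < x → |polygamma i x| = i.factorial * zetaSeries (i + 1) x :=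
    fun x hx => abs_polygamma hi hx
  obtain ⟨θ, hθ, h0⟩ := exists_zetaSeries_sq_eq hp
  refine ⟨θ, hθ, ?_, fun θ' hθ' h' => ?_, fun x y hx hy => ?_⟩
  · rw [habs _ hθ.1, habs _ (pow_pos hθ.1 2)]
    linear_combination (-(i.factorial : ℝ)) * h0
  · rw [habs _ hθ'.1, habs _ (pow_pos hθ'.1 2)] at h'
    refine (strictAntiOn_zetaSeries_sq_sub hp).injOn hθ' hθ ?_
    simp only [h0]
    refine mul_left_cancel₀ hf.ne' ?_
    linear_combination -h'
  · rw [habs _ (Real.exp_pos _), habs _ (Real.exp_pos _), habs _ (Real.exp_pos _), ← mul_add,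
      Real.exp_add]
    refine mul_le_mul_of_nonneg_left ?_ hf.le
    have hx' : θ < Real.exp x := (Real.log_lt_iff_lt_exp hθ.1).1 hx
    have hy' : θ < Real.exp y := (Real.log_lt_iff_lt_exp hθ.1).1 hy
    rcases le_total (Real.exp x) (Real.exp y) with h | h
    · exact zetaSeries_mul_le hp hθ h0 hx' h
    · rw [mul_comm (Real.exp x), add_comm (zetaSeries _ (Real.exp x))]
      exact zetaSeries_mul_le hp hθ h0 hy' h
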